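/- (Self-adjointness, Proposition 4.2) Multiplication by p is self-adjoint with respect to the intersection pairing: the matrices M and S satisfy Mᵀ·S = S·M, i.e. ⟨⟨p∘c_α, c_β⟩⟩ = ⟨⟨c_α, p∘c_β⟩⟩ for all 0 ≤ α, β ≤ σ−1. -/

import Mathlib

open Finset

/-- The set `F = { l / w j : 0 ≤ l ≤ w j - 1, 0 ≤ j ≤ n }` of rational numbers. -/
def wpF (n : ℕ) (w : Fin (n + 1) → ℕ) : Finset ℚ :=
  (Finset.univ.sigma fun j : Fin (n + 1) => Finset.range (w j)).image
    fun p => (p.2 : ℚ) / (w p.1 : ℚ)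

-- The set `S f = { j ∈ {0,…,n} : w j · f ∈ ℤ }`.
open Classical in
noncomputable def wpS (n : ℕ) (w : Fin (n + 1) → ℕ) (x : ℚ) : Finset (Fin (n + 1)) :=
  Finset.univ.filter fun j => ∃ z : ℤ, (w j : ℚ) * x = (z : ℚ)

lemma mem_wpS {n : ℕ} {w : Fin (n + 1) → ℕ} {x : ℚ} {j : Fin (n + 1)} :
    j ∈ wpS n w x ↔ ∃ z : ℤ, (w j : ℚ) * x = z := by
  simp [wpS]

lemma mem_wpF {n : ℕ} {w : Fin (n + 1) → ℕ} {x : ℚ} :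
    x ∈ wpF n w ↔ ∃ j, ∃ l < w j, (l : ℚ) / w j = x := by
  simp [wpF]

lemma wpS_zero (n : ℕ) (w : Fin (n + 1) → ℕ) : wpS n w 0 = univ := by
  ext j
  simp only [mem_wpS, mem_univ, iff_true]
  exact ⟨0, by simp⟩

lemma wpS_one_sub (n : ℕ) (w : Fin (n + 1) → ℕ) (x : ℚ) : wpS n w (1 - x) = wpS n w x := by
  ext j
  simp only [mem_wpS]
  constructor
  · rintro ⟨z, hz⟩
    exact ⟨w j - z, by push_cast; linarith⟩
  · rintro ⟨z, hz⟩
    exact ⟨w j - z, by push_cast; linarith⟩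

lemma wpS_card_pos {n : ℕ} {w : Fin (n + 1) → ℕ} {x : ℚ} (hx : x ∈ wpF n w) :
    0 < (wpS n w x).card := by
  obtain ⟨j, l, hl, rfl⟩ := mem_wpF.1 hx
  refine card_pos.2 ⟨j, mem_wpS.2 ⟨l, ?_⟩⟩
  have : (w j : ℚ) ≠ 0 := by exact_mod_cast (by omega : w j ≠ 0)
  push_cast
  field_simp

lemma nonneg_of_mem_wpF {n : ℕ} {w : Fin (n + 1) → ℕ} {x : ℚ} (hx : x ∈ wpF n w) : 0 ≤ x := by
  obtain ⟨j, l, -, rfl⟩ := mem_wpF.1 hx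
  positivity

lemma lt_one_of_mem_wpF {n : ℕ} {w : Fin (n + 1) → ℕ} {x : ℚ} (hx : x ∈ wpF n w) : x < 1 := by
  obtain ⟨j, l, hl, rfl⟩ := mem_wpF.1 hx
  have : (0 : ℚ) < w j := by exact_mod_cast (by omega : 0 < w j)
  rw [div_lt_one this]
  exact_mod_cast hl

lemma zero_mem_wpF {n : ℕ} {w : Fin (n + 1) → ℕ} (hw : ∀ j, 0 < w j) : (0 : ℚ) ∈ wpF n w :=
  mem_wpF.2 ⟨0, 0, hw 0, by simp⟩

lemma one_sub_mem_wpF {n : ℕ} {w : Fin (n + 1) → ℕ} {x : ℚ} (hx : x ∈ wpF n w) (h0 : x ≠ 0) :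
    1 - x ∈ wpF n w := by
  obtain ⟨j, l, hl, rfl⟩ := mem_wpF.1 hx
  have hl0 : l ≠ 0 := by rintro rfl; simp at h0
  have hj : (w j : ℚ) ≠ 0 := by exact_mod_cast (by omega : w j ≠ 0)
  refine mem_wpF.2 ⟨j, w j - l, by omega, ?_⟩
  rw [Nat.cast_sub hl.le]
  field_simp

lemma card_filter_mem_wpS {n : ℕ} {w : Fin (n + 1) → ℕ} (hw : ∀ j, 0 < w j) (j : Fin (n + 1)) :
    ((wpF n w).filter fun x => j ∈ wpS n w x).card = w j := by
  have hj : (w j : ℚ) ≠ 0 := by exact_mod_cast (hw j).ne'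
  have himage : (wpF n w).filter (fun x => j ∈ wpS n w x) =
      (range (w j)).image fun l : ℕ => (l : ℚ) / w j := by
    ext x
    simp only [mem_filter, mem_image, mem_range, mem_wpS]
    constructor
    · rintro ⟨hx, z, hz⟩
      have hjp : (0 : ℚ) < w j := by exact_mod_cast hw j
      have hz0 : 0 ≤ z := by
        have : (0 : ℚ) ≤ z := hz ▸ mul_nonneg hjp.le (nonneg_of_mem_wpF hx)
        exact_mod_cast this
      lift z to ℕ using hz0
      push_cast at hz
      refine ⟨z, ?_, by rw [← hz]; field_simp⟩
      have : (z : ℚ) < w j := by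
        rw [← hz]
        exact mul_lt_of_lt_one_right hjp (lt_one_of_mem_wpF hx)
      exact_mod_cast this
    · rintro ⟨l, hl, rfl⟩
      exact ⟨mem_wpF.2 ⟨j, l, hl, rfl⟩, l, by push_cast; field_simp⟩
  rw [himage, card_image_of_injective, card_range]
  intro a b hab
  have : (a : ℚ) = b := by simpa [div_left_inj' hj] using hab
  exact_mod_cast this

lemma sum_card_wpS {n : ℕ} {w : Fin (n + 1) → ℕ} (hw : ∀ j, 0 < w j) :
    ∑ x ∈ wpF n w, (wpS n w x).card = ∑ j, w j := by
  have h := sum_card_bipartiteAbove_eq_sum_card_bipartiteBelow (s := wpF n w)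
    (t := (univ : Finset (Fin (n + 1)))) (fun x j => j ∈ wpS n w x)
  simp only [bipartiteAbove, bipartiteBelow, card_filter_mem_wpS hw] at h
  simpa using h

/-- An increasing enumeration `f 1 < ⋯ < f (k + 1)` of a set stable under `x ↦ 1 - x` is
symmetric. -/
lemma enumeration_reflect {k : ℕ} {f : ℕ → ℚ}
    (hmono : ∀ i j : ℕ, 1 ≤ i → i < j → j ≤ k + 1 → f i < f j)
    (hrefl : ∀ i : ℕ, 1 ≤ i → i ≤ k + 1 → ∃ j : ℕ, 1 ≤ j ∧ j ≤ k + 1 ∧ f j = 1 - f i)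
    {i : ℕ} (h1 : 1 ≤ i) (hi : i ≤ k + 1) : f (k + 2 - i) = 1 - f i := by
  let g : Fin (k + 1) → ℚ := fun a => f (a + 1)
  let h : Fin (k + 1) → ℚ := fun a => 1 - f (k + 1 - a)
  have hg : StrictMono g := fun a b hab => hmono _ _ (by omega) (by omega) (by omega)
  have hh : StrictMono h := fun a b hab =>
    sub_lt_sub_left (hmono _ _ (by omega) (by omega) (by omega)) 1
  have hrange : Set.range g = Set.range h := by
    ext x
    constructor
    · rintro ⟨a, rfl⟩
      obtain ⟨j, hj1, hjk, hj⟩ := hrefl (a + 1) (by omega) (by omega)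
      refine ⟨⟨k + 1 - j, by omega⟩, ?_⟩
      simp only [g, h]
      rw [show k + 1 - (k + 1 - j) = j by omega, hj]
      ring
    · rintro ⟨a, rfl⟩
      obtain ⟨j, hj1, hjk, hj⟩ := hrefl (k + 1 - a) (by omega) (by omega)
      refine ⟨⟨j - 1, by omega⟩, ?_⟩
      simp only [g, h]
      rw [show j - 1 + 1 = j by omega, hj]
  have heq := congrFun ((hg.range_inj hh).1 hrange) ⟨k + 1 - i, by omega⟩
  simp only [g, h] at heq
  rwa [show k + 1 - i + 1 = k + 2 - i by omega, show k + 1 - (k + 1 - i) = i by omega] at heq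

/-- Partial sums of a sequence with `u (k + 2 - i) = u i` for `2 ≤ i ≤ k`. -/
lemma sum_Icc_add_sum_Icc_reflect {k : ℕ} {u : ℕ → ℕ}
    (hu : ∀ i, 2 ≤ i → i ≤ k → u (k + 2 - i) = u i) {i : ℕ} (h1 : 1 ≤ i) (hi : i ≤ k) :
    ∑ l ∈ Icc 1 i, u l + ∑ l ∈ Icc 1 (k + 1 - i), u l = ∑ l ∈ Icc 1 k, u l + u 1 := by
  induction i, h1 using Nat.le_induction with
  | base => simp [add_comm]
  | succ i h1 ih =>
    have ih := ih (by omega)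
    rw [show k + 1 - i = (k + 1 - (i + 1)) + 1 by omega, sum_Icc_succ_top (by omega)] at ih
    rw [sum_Icc_succ_top (by omega)]
    have := hu (i + 1) (by omega) hi
    rw [show k + 2 - (i + 1) = k + 1 - (i + 1) + 1 by omega] at this
    omega

lemma exists_block {u : ℕ → ℕ} {k a : ℕ} (ha : a < ∑ l ∈ Icc 1 k, u l) :
    ∃ i, 1 ≤ i ∧ i ≤ k ∧ ∑ l ∈ Icc 1 (i - 1), u l ≤ a ∧ a < ∑ l ∈ Icc 1 i, u l := by
  induction k with
  | zero => simp at ha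
  | succ k ih =>
    by_cases h : a < ∑ l ∈ Icc 1 k, u l
    · obtain ⟨i, h1, hi, h2⟩ := ih h
      exact ⟨i, h1, by omega, h2⟩
    · exact ⟨k + 1, by omega, le_rfl, by simpa using h, ha⟩

theorem self_adjointness (n k : ℕ) (w : Fin (n + 1) → ℕ) (hw : ∀ j, 0 < w j)
    (f : ℕ → ℚ)
    (hmono : ∀ i j : ℕ, 1 ≤ i → i < j → j ≤ k + 1 → f i < f j)
    (hmem : ∀ i : ℕ, 1 ≤ i → i ≤ k → f i ∈ wpF n w)
    (hsurj : ∀ x ∈ wpF n w, ∃ i : ℕ, 1 ≤ i ∧ i ≤ k ∧ f i = x)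
    (hf1 : f 1 = 0) (hfk1 : f (k + 1) = 1)
    (q : ℝ) (hq : 0 < q)
    (r : ℕ → ℝ)
    (hr_jump : ∀ α i : ℕ, 1 ≤ i → i ≤ k →
      α = ∑ l ∈ Finset.Icc 1 i, (wpS n w (f l)).card →
      r α = (1 / ∏ l ∈ wpS n w (f i), (w l : ℝ)) * q ^ ((f (i + 1) - f i : ℚ) : ℝ))
    (hr_one : ∀ α : ℕ, 1 ≤ α → α ≤ ∑ j, w j →
      (∀ i : ℕ, 1 ≤ i → i ≤ k → α ≠ ∑ l ∈ Finset.Icc 1 i, (wpS n w (f l)).card) →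
      r α = 1)
    (M : Matrix (Fin (∑ j, w j)) (Fin (∑ j, w j)) ℝ)
    (hM : ∀ β α : Fin (∑ j, w j),
      M β α = if (β : ℕ) = ((α : ℕ) + 1) % (∑ j, w j) then r ((α : ℕ) + 1) else 0)
    (S : Matrix (Fin (∑ j, w j)) (Fin (∑ j, w j)) ℝ)
    (hS_top : ∀ α β : Fin (∑ j, w j), (α : ℕ) + (β : ℕ) = n →
      S α β = 1 / ∏ l ∈ wpS n w (f 1), (w l : ℝ))
    (hS_block : ∀ α β : Fin (∑ j, w j), ∀ i : ℕ, 1 ≤ i → i ≤ k - 1 →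
      (α : ℕ) + (β : ℕ) = (∑ j, w j) + n →
      (∑ l ∈ Finset.Icc 1 i, (wpS n w (f l)).card) ≤ (α : ℕ) →
      (α : ℕ) ≤ (∑ l ∈ Finset.Icc 1 (i + 1), (wpS n w (f l)).card) - 1 →
      S α β = 1 / ∏ l ∈ wpS n w (f (i + 1)), (w l : ℝ))
    (hS_zero : ∀ α β : Fin (∑ j, w j), (α : ℕ) + (β : ℕ) ≠ n →
      ¬((α : ℕ) + (β : ℕ) = (∑ j, w j) + n ∧ ∃ i : ℕ, 1 ≤ i ∧ i ≤ k - 1 ∧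
        (∑ l ∈ Finset.Icc 1 i, (wpS n w (f l)).card) ≤ (α : ℕ) ∧
        (α : ℕ) ≤ (∑ l ∈ Finset.Icc 1 (i + 1), (wpS n w (f l)).card) - 1) →
      S α β = 0) :
    M.transpose * S = S * M := by
  have hk : 1 ≤ k := by
    obtain ⟨i, h1, hi, -⟩ := hsurj 0 (zero_mem_wpF hw)
    omega
  have hf_reflect : ∀ i, 1 ≤ i → i ≤ k + 1 → f (k + 2 - i) = 1 - f i := by
    intro i h1 hi
    refine enumeration_reflect hmono (fun i h1 hi => ?_) h1 hi
    rcases eq_or_ne i (k + 1) with rfl | hik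
    · exact ⟨1, le_rfl, by omega, by rw [hf1, hfk1]; norm_num⟩
    rcases eq_or_ne i 1 with rfl | hi1
    · exact ⟨k + 1, by omega, le_rfl, by rw [hf1, hfk1]; norm_num⟩
    have h0 : f i ≠ 0 := hf1 ▸ (hmono 1 i le_rfl (by omega) hi).ne'
    obtain ⟨j, hj1, hjk, hj⟩ := hsurj _ (one_sub_mem_wpF (hmem i h1 (by omega)) h0)
    exact ⟨j, hj1, by omega, hj⟩
  have hS_reflect : ∀ i, 1 ≤ i → i ≤ k + 1 → wpS n w (f (k + 2 - i)) = wpS n w (f i) := by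
    intro i h1 hi
    rw [hf_reflect i h1 hi, wpS_one_sub]
  have hsum : ∑ l ∈ Icc 1 k, (wpS n w (f l)).card = ∑ j, w j := by
    rw [← sum_card_wpS hw]
    refine sum_bij (fun i _ => f i) ?_ ?_ ?_ (fun _ _ => rfl)
    · intro i hi
      rw [mem_Icc] at hi
      exact hmem i hi.1 hi.2
    · intro a ha b hb hab
      rw [mem_Icc] at ha hb
      rcases lt_trichotomy a b with h | h | h
      · exact absurd hab (hmono a b ha.1 h (by omega)).ne
      · exact h
      · exact absurd hab (hmono b a hb.1 h (by omega)).ne'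
    · intro x hx
      obtain ⟨i, h1, hi, h⟩ := hsurj x hx
      exact ⟨i, mem_Icc.2 ⟨h1, hi⟩, h⟩
  have hu_one : (wpS n w (f 1)).card = n + 1 := by simp [hf1, wpS_zero]
  have hU_reflect := fun i (h1 : 1 ≤ i) (hi : i ≤ k) =>
    sum_Icc_add_sum_Icc_reflect (k := k) (u := fun l => (wpS n w (f l)).card)
      (fun i h2 hi => by simp only [hS_reflect i (by omega) (by omega)]) h1 hi
  have hu_pos : ∀ i, 1 ≤ i → i ≤ k → 0 < (wpS n w (f i)).card :=
    fun i h1 hi => wpS_card_pos (hmem i h1 hi)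
  have hU_mono : Monotone fun i => ∑ l ∈ Icc 1 i, (wpS n w (f l)).card :=
    fun a b hab => sum_le_sum_of_subset (Icc_subset_Icc_right hab)
  have hU_succ : ∀ i, ∑ l ∈ Icc 1 (i + 1), (wpS n w (f l)).card =
      ∑ l ∈ Icc 1 i, (wpS n w (f l)).card + (wpS n w (f (i + 1))).card :=
    fun i => sum_Icc_succ_top (by omega) _
  have hblock := fun a => exists_block (u := fun l => (wpS n w (f l)).card) (k := k) (a := a)
  have hU_zero : ∑ l ∈ Icc 1 0, (wpS n w (f l)).card = 0 := by simp
  generalize hu : (fun i => (wpS n w (f i)).card) = u at *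
  replace hu : ∀ i, (wpS n w (f i)).card = u i := fun i => congrFun hu i
  generalize hm : (fun i => ∏ l ∈ wpS n w (f i), (w l : ℝ)) = m at *
  replace hm : ∀ i, ∏ l ∈ wpS n w (f i), (w l : ℝ) = m i := fun i => congrFun hm i
  have hm_reflect : ∀ i, 1 ≤ i → i ≤ k + 1 → m (k + 2 - i) = m i := by
    intro i h1 hi
    rw [← hm, ← hm, hS_reflect i h1 hi]
  simp only [hu, hm] at *
  generalize hU : (fun i => ∑ l ∈ Icc 1 i, u l) = U at *
  have hU' : ∀ i, ∑ l ∈ Icc 1 i, u l = U i := fun i => congrFun hU i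
  simp only [hU'] at *
  generalize hσ : ∑ j, w j = σ at *
  have hU1 : U 1 = n + 1 := by have := hU_succ 0; simp only [zero_add] at this; omega
  have hσn : n + 1 ≤ σ := by have := hU_mono hk; omega
  have hS_eq : ∀ a b : Fin σ, (a : ℕ) + b = n ∨ (a : ℕ) + b = σ + n →
      ∀ i, 1 ≤ i → i ≤ k → U (i - 1) ≤ a → (a : ℕ) < U i → S a b = 1 / m i := by
    intro a b hab i h1 hi hl hr
    rcases eq_or_ne i 1 with rfl | hi1
    · exact hS_top a b (by omega)
    · have := hU_mono (show 1 ≤ i - 1 by omega)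
      have h := hS_block a b (i - 1) (by omega) (by omega) (by omega) hl
      rw [show i - 1 + 1 = i by omega] at h
      exact h (by omega)
  have hS_eq_zero : ∀ a b : Fin σ, (a : ℕ) + b ≠ n → (a : ℕ) + b ≠ σ + n → S a b = 0 :=
    fun a b h1 h2 => hS_zero a b h1 fun h => h2 h.1
  ext α β
  have hα := α.2
  have hβ := β.2
  have hmod : ∀ a < σ, (a + 1 < σ ∧ (a + 1) % σ = a + 1) ∨ (a + 1 = σ ∧ (a + 1) % σ = 0) := by
    intro a ha
    rcases (show a + 1 < σ ∨ a + 1 = σ by omega) with h | h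
    · exact .inl ⟨h, Nat.mod_eq_of_lt h⟩
    · exact .inr ⟨h, by rw [h, Nat.mod_self]⟩
  let next : Fin σ → Fin σ := fun a => ⟨(a + 1) % σ, Nat.mod_lt _ (by omega)⟩
  have hM' : ∀ b a, M b a = if b = next a then r (a + 1) else 0 := by
    intro b a
    rw [hM]
    simp only [next, Fin.ext_iff]
  have hleft : (M.transpose * S) α β = r (α + 1) * S (next α) β := by
    simp [Matrix.mul_apply, hM']
  have hright : (S * M) α β = S α (next β) * r (β + 1) := by
    simp [Matrix.mul_apply, hM']
  rw [hleft, hright]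
  have hnα : (next α : ℕ) = (α + 1) % σ := rfl
  have hnβ : (next β : ℕ) = (β + 1) % σ := rfl
  have hmα := hmod α hα
  have hmβ := hmod β hβ
  by_cases hP : (α : ℕ) + β + 1 = n ∨ (α : ℕ) + β + 1 = σ + n
  swap
  · rw [hS_eq_zero (next α) β (by omega) (by omega), hS_eq_zero α (next β) (by omega) (by omega)]
    simp
  have hPα : (next α : ℕ) + β = n ∨ (next α : ℕ) + β = σ + n := by omega
  have hPβ : (α : ℕ) + next β = n ∨ (α : ℕ) + next β = σ + n := by omega
  by_cases hjump : ∃ i, 1 ≤ i ∧ i ≤ k ∧ (α : ℕ) + 1 = U i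
  · obtain ⟨i, h1, hi, hαi⟩ := hjump
    have hUi := hU_reflect i h1 hi
    have hUi1 := hU_mono h1
    have hpred := hU_succ (i - 1)
    rw [show i - 1 + 1 = i by omega] at hpred
    have hui := hu_pos i h1 hi
    have hrβ := hr_jump (β + 1) (k + 1 - i) (by omega) (by omega) (by omega)
    have hmi := hm_reflect (i + 1) (by omega) (by omega)
    rw [show k + 2 - (i + 1) = k + 1 - i by omega] at hmi
    have hfi := hf_reflect i h1 (by omega)
    have hfi1 := hf_reflect (i + 1) (by omega) (by omega)
    rw [show k + 2 - (i + 1) = k + 1 - i by omega] at hfi1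
    rw [show k + 1 - i + 1 = k + 2 - i by omega, hmi, hfi, hfi1,
      show 1 - f i - (1 - f (i + 1)) = f (i + 1) - f i by ring] at hrβ
    have hSα : S (next α) β = 1 / m (i + 1) := by
      rcases eq_or_ne i k with rfl | hik
      · have := hm_reflect 1 le_rfl (by omega)
        rw [show i + 2 - 1 = i + 1 by omega] at this
        rw [this]
        exact hS_eq _ _ hPα 1 le_rfl hk (by rw [Nat.sub_self]; omega) (by omega)
      · have := hU_succ i
        have := hu_pos (i + 1) (by omega) (by omega)
        have := hU_mono (show i + 1 ≤ k by omega)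
        exact hS_eq _ _ hPα (i + 1) (by omega) (by omega)
          (by rw [Nat.add_sub_cancel]; omega) (by omega)
    rw [hrβ, hr_jump (α + 1) i h1 hi hαi, hSα,
      hS_eq α (next β) hPβ i h1 hi (by omega) (by omega)]
    ring
  · push Not at hjump
    obtain ⟨i, h1, hi, hl, hr⟩ := hblock α (by omega)
    have hne := hjump i h1 hi
    have hik := hU_mono hi
    rw [hr_one (α + 1) (by omega) (by omega) hjump, hr_one (β + 1) (by omega) (by omega),
      hS_eq (next α) β hPα i h1 hi (by omega) (by omega), hS_eq α (next β) hPβ i h1 hi hl hr]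
    · ring
    · intro j hj1 hj hβj
      have := hU_reflect j hj1 hj
      have := hU_mono hj1
      refine hjump (k + 1 - j) (by omega) (by omega) ?_
      omega
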